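/- For any vector v = (v_1,…,v_t) of positive integers with n = Σ v_i and any k ≥ 0, the generating polynomial Σ_{π ∈ M(v), des(π)=k} q^{maj(π)} over multiset permutations of {1^{v_1} ⋯ t^{v_t}} with exactly k descents is either zero or a symmetric unimodal polynomial in q with nonnegative coefficients and darga equal to nk. -/

import Mathlib

open Finset
open scoped Classical

noncomputable section

/-- Multiset permutations: words `w : Fin n → Fin t` using exactly `v a` copies
of each letter `a`. -/
def multisetPerms (n t : ℕ) (v : Fin t → ℕ) : Finset (Fin n → Fin t) :=
  Finset.univ.filter fun w => ∀ a, (Finset.univ.filter fun i => w i = a).card = v a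

/-- The descent set of a word. -/
def wDescSet {n t : ℕ} (w : Fin n → Fin t) : Finset (Fin n) :=
  Finset.univ.filter fun i => ∃ h : (i : ℕ) + 1 < n, w ⟨(i : ℕ) + 1, h⟩ < w i

/-- The number of descents of a word. -/
def wDes {n t : ℕ} (w : Fin n → Fin t) : ℕ := (wDescSet w).card

/-- The major index of a word (descent positions counted 1-based). -/
def wMaj {n t : ℕ} (w : Fin n → Fin t) : ℕ := ∑ i ∈ wDescSet w, ((i : ℕ) + 1)

/-- Symmetric polynomial with nonnegative coefficients. -/
def IsSymmPoly (f : Polynomial ℕ) : Prop :=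
  ∀ k ≤ f.natDegree - f.natTrailingDegree,
    f.coeff (f.natTrailingDegree + k) = f.coeff (f.natDegree - k)

/-- Unimodal polynomial. -/
def IsUnimodalPoly (f : Polynomial ℕ) : Prop :=
  ∃ p : ℕ, (∀ i j, i ≤ j → j ≤ p → f.coeff i ≤ f.coeff j) ∧
    (∀ i j, p ≤ i → i ≤ j → f.coeff j ≤ f.coeff i)

/-- Zero, or symmetric and unimodal with darga `d`. -/
def ZSU (f : Polynomial ℕ) (d : ℕ) : Prop :=
  f = 0 ∨ (IsSymmPoly f ∧ IsUnimodalPoly f ∧ f.natTrailingDegree + f.natDegree = d)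

end

section QBinomial

variable {R S : Type*}

/-- The Gaussian binomial coefficient evaluated at `q`. -/
def qBinom [CommSemiring R] (q : R) : ℕ → ℕ → R
  | _, 0 => 1
  | 0, _ + 1 => 0
  | n + 1, k + 1 => qBinom q n k + q ^ (k + 1) * qBinom q n (k + 1)

section CommSemiring

variable [CommSemiring R] [CommSemiring S] (q : R)

@[simp] lemma qBinom_zero_right (n : ℕ) : qBinom q n 0 = 1 := by
  cases n <;> rfl

@[simp] lemma qBinom_zero_succ (k : ℕ) : qBinom q 0 (k + 1) = 0 := rfl

lemma qBinom_succ_succ (n k : ℕ) :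
    qBinom q (n + 1) (k + 1) = qBinom q n k + q ^ (k + 1) * qBinom q n (k + 1) := rfl

lemma qBinom_eq_zero_of_lt {n k : ℕ} (h : n < k) : qBinom q n k = 0 := by
  induction n generalizing k with
  | zero => obtain ⟨k, rfl⟩ := Nat.exists_eq_succ_of_ne_zero h.ne'; rfl
  | succ n ih =>
    obtain ⟨k, rfl⟩ := Nat.exists_eq_succ_of_ne_zero (Nat.ne_zero_of_lt h)
    rw [Nat.succ_eq_add_one, qBinom_succ_succ, ih (by omega), ih (by omega)]
    simp

@[simp] lemma qBinom_self (n : ℕ) : qBinom q n n = 1 := by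
  induction n with
  | zero => rfl
  | succ n ih => rw [qBinom_succ_succ, ih, qBinom_eq_zero_of_lt q (Nat.lt_succ_self n)]; simp

lemma map_qBinom (f : R →+* S) (n k : ℕ) : f (qBinom q n k) = qBinom (f q) n k := by
  induction n generalizing k with
  | zero => cases k <;> simp
  | succ n ih => cases k <;> simp [qBinom_succ_succ, ih]

/-- The second Pascal recursion. -/
lemma qBinom_succ_succ' (n k : ℕ) :
    qBinom q (n + 1) (k + 1) = q ^ (n - k) * qBinom q n k + qBinom q n (k + 1) := by
  induction n generalizing k with
  | zero => cases k <;> simp [qBinom_succ_succ]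
  | succ n ih =>
    cases k with
    | zero =>
      have h : qBinom q (n + 1) 1 = 1 + q * qBinom q n 1 := by simp [qBinom_succ_succ]
      have h2 := ih 0
      have h3 := qBinom_succ_succ q (n + 1) 0
      simp only [qBinom_zero_right, Nat.sub_zero, zero_add, pow_one, mul_one] at h2 h3 ⊢
      rw [h3, h2, mul_add, ← add_assoc, add_comm 1, ← pow_succ', add_assoc, ← h, h2]
    | succ k =>
      rw [qBinom_succ_succ q (n + 1) (k + 1), Nat.add_sub_add_right]
      conv_lhs => rw [ih k, ih (k + 1)]
      conv_rhs => rw [qBinom_succ_succ q n k, qBinom_succ_succ q n (k + 1)]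
      rcases Nat.lt_or_ge n (k + 1) with h | h
      · rw [qBinom_eq_zero_of_lt q h, qBinom_eq_zero_of_lt q (by omega : n < k + 1 + 1)]
        ring
      · obtain ⟨m, rfl⟩ := Nat.exists_eq_add_of_le h
        rw [show k + 1 + m - (k + 1) = m by omega, show k + 1 + m - k = m + 1 by omega]
        ring

end CommSemiring

section CommRing

variable [CommRing R] (q : R)

lemma one_sub_pow_mul_qBinom_succ (n k : ℕ) :
    (1 - q ^ (k + 1)) * qBinom q n (k + 1) = (1 - q ^ (n - k)) * qBinom q n k := by
  linear_combination qBinom_succ_succ q n k - qBinom_succ_succ' q n k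

lemma one_sub_pow_mul_qBinom_succ_succ (n k : ℕ) :
    (1 - q ^ (k + 1)) * qBinom q (n + 1) (k + 1) = (1 - q ^ (n + 1)) * qBinom q n k := by
  rcases Nat.lt_or_ge n k with h | h
  · rw [qBinom_eq_zero_of_lt q h, qBinom_eq_zero_of_lt q (by omega)]; simp
  · obtain ⟨m, rfl⟩ := Nat.exists_eq_add_of_le h
    have h1 := one_sub_pow_mul_qBinom_succ q (k + m) k
    rw [Nat.add_sub_cancel_left] at h1
    rw [qBinom_succ_succ]
    linear_combination q ^ (k + 1) * h1

end CommRing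

end QBinomial

section SymmetricUnimodal

open Polynomial

/-- `f` is symmetric about `d / 2` and its coefficients increase up to `d / 2`. -/
structure SymmUnimodal (f : ℕ[X]) (d : ℕ) : Prop where
  coeff_symm : ∀ i ≤ d, f.coeff i = f.coeff (d - i)
  coeff_eq_zero : ∀ i, d < i → f.coeff i = 0
  coeff_le_succ : ∀ i, 2 * i < d → f.coeff i ≤ f.coeff (i + 1)

namespace SymmUnimodal

lemma zero (d : ℕ) : SymmUnimodal 0 d := ⟨by simp, by simp, by simp⟩

lemma add {f g : ℕ[X]} {d : ℕ} (hf : SymmUnimodal f d) (hg : SymmUnimodal g d) :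
    SymmUnimodal (f + g) d where
  coeff_symm i hi := by simp [hf.coeff_symm i hi, hg.coeff_symm i hi]
  coeff_eq_zero i hi := by simp [hf.coeff_eq_zero i hi, hg.coeff_eq_zero i hi]
  coeff_le_succ i hi := by
    simpa using Nat.add_le_add (hf.coeff_le_succ i hi) (hg.coeff_le_succ i hi)

lemma sum {ι : Type*} {s : Finset ι} {f : ι → ℕ[X]} {d : ℕ}
    (h : ∀ i ∈ s, SymmUnimodal (f i) d) : SymmUnimodal (∑ i ∈ s, f i) d :=
  Finset.sum_induction f (fun p => SymmUnimodal p d) (fun _ _ => add) (zero d) h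

lemma coeff_mono {f : ℕ[X]} {d : ℕ} (hf : SymmUnimodal f d) {i j : ℕ} (hij : i ≤ j)
    (hj : 2 * j ≤ d + 1) : f.coeff i ≤ f.coeff j := by
  induction j, hij using Nat.le_induction with
  | base => exact le_rfl
  | succ j hij ih => exact (ih (by omega)).trans (hf.coeff_le_succ j (by omega))

lemma zsu {f : ℕ[X]} {d : ℕ} (hf : SymmUnimodal f d) : ZSU f d := by
  by_cases h0 : f = 0
  · exact Or.inl h0
  have hD : f.coeff f.natDegree ≠ 0 := by simpa using h0
  have he : f.coeff f.natTrailingDegree ≠ 0 := by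
    simpa [Polynomial.trailingCoeff] using (Polynomial.trailingCoeff_nonzero_iff_nonzero).2 h0
  have hDd : f.natDegree ≤ d := by
    by_contra! h
    exact hD (hf.coeff_eq_zero _ h)
  have hed : f.natTrailingDegree ≤ d :=
    (Polynomial.natTrailingDegree_le_natDegree f).trans hDd
  have h1 : f.natTrailingDegree ≤ d - f.natDegree :=
    Polynomial.natTrailingDegree_le_of_ne_zero (by rwa [← hf.coeff_symm _ hDd])
  have h2 : d - f.natTrailingDegree ≤ f.natDegree :=
    Polynomial.le_natDegree_of_ne_zero (by rwa [← hf.coeff_symm _ hed])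
  refine Or.inr ⟨fun k hk => ?_, ⟨d / 2, fun i j hij hj => hf.coeff_mono hij (by omega),
    fun i j hi hij => ?_⟩, by omega⟩
  · rw [hf.coeff_symm _ (by omega)]
    congr 1
    omega
  · rcases Nat.lt_or_ge d j with h | h
    · simp [hf.coeff_eq_zero j h]
    · rw [hf.coeff_symm j h, hf.coeff_symm i (by omega)]
      exact hf.coeff_mono (by omega) (by omega)

lemma X_mul {f : ℕ[X]} {d : ℕ} (hf : SymmUnimodal f d) : SymmUnimodal (X * f) (d + 2) where
  coeff_symm i hi := by
    rcases i with _ | i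
    · simp [show d + 2 = d + 1 + 1 by rfl, hf.coeff_eq_zero (d + 1) (by omega)]
    · rcases Nat.lt_or_ge d i with h | h
      · obtain rfl : i = d + 1 := by omega
        simp [hf.coeff_eq_zero (d + 1) (by omega)]
      · rw [show d + 2 - (i + 1) = d - i + 1 by omega]
        simpa using hf.coeff_symm i h
  coeff_eq_zero i hi := by
    obtain ⟨i, rfl⟩ := Nat.exists_eq_succ_of_ne_zero (Nat.ne_zero_of_lt hi)
    simpa using hf.coeff_eq_zero i (by omega)
  coeff_le_succ i hi := by
    rcases i with _ | i
    · simp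
    · simpa using hf.coeff_le_succ i (by omega)

lemma X_pow_mul {f : ℕ[X]} {d : ℕ} (hf : SymmUnimodal f d) (n : ℕ) :
    SymmUnimodal (X ^ n * f) (d + 2 * n) := by
  induction n with
  | zero => simpa using hf
  | succ n ih =>
    rw [pow_succ', mul_assoc, show d + 2 * (n + 1) = d + 2 * n + 2 by ring]
    exact ih.X_mul

end SymmUnimodal

/-- The polynomial `1 + X + ⋯ + X ^ d`. -/
noncomputable def qInterval (d : ℕ) : ℕ[X] := ∑ i ∈ range (d + 1), X ^ i

lemma coeff_qInterval (d i : ℕ) : (qInterval d).coeff i = if i ≤ d then 1 else 0 := by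
  simp [qInterval, coeff_X_pow]

lemma symmUnimodal_qInterval (d : ℕ) : SymmUnimodal (qInterval d) d where
  coeff_symm i hi := by simp [coeff_qInterval, hi]
  coeff_eq_zero i hi := by simp [coeff_qInterval, hi]
  coeff_le_succ i hi := by simp [coeff_qInterval, show i ≤ d by omega, show i + 1 ≤ d by omega]

lemma qInterval_succ_mul_qInterval_succ (a b : ℕ) :
    qInterval (a + 1) * qInterval (b + 1) =
      qInterval (a + b + 2) + X * (qInterval a * qInterval b) := by
  have h1 : ∀ a, qInterval (a + 1) = 1 + X * qInterval a := fun a => by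
    rw [qInterval, Finset.sum_range_succ', qInterval, Finset.mul_sum]
    simp [pow_succ', add_comm]
  have h2 : qInterval (a + b + 2) = qInterval (a + 1) + X ^ (a + 2) * qInterval b := by
    rw [qInterval, show a + b + 2 + 1 = (a + 2) + (b + 1) by ring, Finset.sum_range_add,
      qInterval, qInterval, Finset.mul_sum]
    simp only [pow_add]
  have h3 : qInterval (a + 1) = qInterval a + X ^ (a + 1) := by
    rw [qInterval, Finset.sum_range_succ, qInterval]
  rw [h2, h1 b, h3]
  ring

lemma symmUnimodal_qInterval_mul_qInterval (a b : ℕ) :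
    SymmUnimodal (qInterval a * qInterval b) (a + b) := by
  have h0 : qInterval 0 = 1 := by simp [qInterval]
  induction a generalizing b with
  | zero => simpa [h0] using symmUnimodal_qInterval b
  | succ a ih =>
    cases b with
    | zero => simpa [h0] using symmUnimodal_qInterval (a + 1)
    | succ b =>
      rw [qInterval_succ_mul_qInterval_succ, show a + 1 + (b + 1) = a + b + 2 by ring]
      exact (symmUnimodal_qInterval _).add (ih b).X_mul

lemma X_mul_mem_closure {f : ℕ[X]} {d : ℕ}
    (hf : f ∈ AddSubmonoid.closure {p | ∃ i m, 2 * i + m = d ∧ p = X ^ i * qInterval m}) :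
    X * f ∈ AddSubmonoid.closure {p | ∃ i m, 2 * i + m = d + 2 ∧ p = X ^ i * qInterval m} := by
  induction hf using AddSubmonoid.closure_induction with
  | mem p hp =>
    obtain ⟨i, m, h, rfl⟩ := hp
    exact AddSubmonoid.subset_closure ⟨i + 1, m, by omega, by ring⟩
  | zero => simp
  | add p r _ _ hp hr =>
    rw [mul_add]
    exact add_mem hp hr

lemma SymmUnimodal.mem_closure {f : ℕ[X]} {d : ℕ} (hf : SymmUnimodal f d) :
    f ∈ AddSubmonoid.closure {p : ℕ[X] | ∃ i m, 2 * i + m = d ∧ p = X ^ i * qInterval m} := by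
  induction d using Nat.strong_induction_on generalizing f with
  | _ d ih =>
  have hmem : f.coeff 0 • qInterval d ∈
      AddSubmonoid.closure {p : ℕ[X] | ∃ i m, 2 * i + m = d ∧ p = X ^ i * qInterval m} := by
    refine nsmul_mem (AddSubmonoid.subset_closure ?_) _
    exact ⟨0, d, by simp⟩
  rcases Nat.lt_or_ge d 2 with hd | hd
  · convert hmem using 1
    ext i
    simp only [coeff_smul, coeff_qInterval, smul_eq_mul, mul_ite, mul_one, mul_zero]
    split_ifs with h
    · rcases Nat.eq_zero_or_pos i with rfl | hi
      · rfl
      · rw [hf.coeff_symm i h, show d - i = 0 by omega]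
    · exact hf.coeff_eq_zero i (by omega)
  · obtain ⟨d, rfl⟩ := Nat.exists_eq_add_of_le' hd
    set g : ℕ[X] := ∑ i ∈ range (d + 1), C (f.coeff (i + 1) - f.coeff 0) * X ^ i with hg
    have hge : ∀ i ≤ d, f.coeff 0 ≤ f.coeff (i + 1) := fun i hi => by
      rcases Nat.lt_or_ge (d + 1) (2 * (i + 1)) with h | h
      · rw [hf.coeff_symm (i + 1) (by omega)]
        exact hf.coeff_mono (Nat.zero_le _) (by omega)
      · exact hf.coeff_mono (Nat.zero_le _) (by omega)
    have hgc : ∀ i, g.coeff i = if i ≤ d then f.coeff (i + 1) - f.coeff 0 else 0 := fun i => by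
      simp [hg, coeff_X_pow]
    have hfg : f = f.coeff 0 • qInterval (d + 2) + X * g := by
      ext i
      rcases i with _ | i
      · simp [coeff_qInterval]
      · simp only [coeff_add, coeff_smul, coeff_qInterval, coeff_X_mul, hgc, smul_eq_mul]
        split_ifs with h1 h2 h2
        · have := hge i h2
          omega
        · obtain rfl : i = d + 1 := by omega
          rw [hf.coeff_symm _ (by omega)]
          simp
        · omega
        · rw [hf.coeff_eq_zero _ (by omega)]
          simp
    have hgs : SymmUnimodal g d := by
      refine ⟨fun i hi => ?_, fun i hi => ?_, fun i hi => ?_⟩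
      · rw [hgc, hgc, if_pos hi, if_pos (Nat.sub_le _ _), hf.coeff_symm (i + 1) (by omega)]
        congr 2
        omega
      · rw [hgc, if_neg (by omega)]
      · rw [hgc, hgc, if_pos (by omega), if_pos (by omega)]
        exact Nat.sub_le_sub_right (hf.coeff_le_succ (i + 1) (by omega)) _
    rw [hfg]
    exact add_mem hmem (X_mul_mem_closure (ih d (by omega) hgs))

lemma SymmUnimodal.mul {f g : ℕ[X]} {d e : ℕ} (hf : SymmUnimodal f d) (hg : SymmUnimodal g e) :
    SymmUnimodal (f * g) (d + e) := by
  have hf' := hf.mem_closure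
  have hg' := hg.mem_closure
  clear hf hg
  induction hf' using AddSubmonoid.closure_induction with
  | zero => simpa using SymmUnimodal.zero _
  | add p r _ _ hp hr =>
    rw [add_mul]
    exact hp.add hr
  | mem p hp =>
    obtain ⟨i, m, h, rfl⟩ := hp
    induction hg' using AddSubmonoid.closure_induction with
    | zero => simpa using SymmUnimodal.zero _
    | add p r _ _ hp hr =>
      rw [mul_add]
      exact hp.add hr
    | mem p hp =>
      obtain ⟨j, n, h', rfl⟩ := hp
      rw [show X ^ i * qInterval m * (X ^ j * qInterval n) =
        X ^ (i + j) * (qInterval m * qInterval n) by ring,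
        show d + e = m + n + 2 * (i + j) by omega]
      exact (symmUnimodal_qInterval_mul_qInterval m n).X_pow_mul _

end SymmetricUnimodal

section SlTwo

open MvPolynomial

variable {N : ℕ}

/-- The derivation scaling each variable `X i` by `c i`. -/
noncomputable def scaleDer {σ : Type*} (c : σ → ℚ) :
    Derivation ℚ (MvPolynomial σ ℚ) (MvPolynomial σ ℚ) :=
  mkDerivation ℚ fun i => c i • X i

lemma scaleDer_monomial {σ : Type*} [Fintype σ] (c : σ → ℚ) (s : σ →₀ ℕ) (r : ℚ) :
    scaleDer c (monomial s r) = (∑ i, c i * s i) • monomial s r := by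
  rw [scaleDer, mkDerivation_monomial, Finsupp.sum_fintype _ _ (by simp), Finset.sum_smul,
    Finset.smul_sum]
  refine Finset.sum_congr rfl fun i _ => ?_
  rcases Nat.eq_zero_or_pos (s i) with h | h
  · simp [h]
  · have hs : s - Finsupp.single i 1 + Finsupp.single i 1 = s :=
      tsub_add_cancel_of_le (Finsupp.single_le_iff.2 h)
    rw [smul_eq_mul, X, smul_monomial, monomial_mul, smul_monomial, hs, smul_monomial]
    congr 1
    simp only [smul_eq_mul]
    ring

lemma coeff_scaleDer {σ : Type*} [Fintype σ] (c : σ → ℚ) (φ : MvPolynomial σ ℚ) (d : σ →₀ ℕ) :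
    coeff d (scaleDer c φ) = (∑ i, c i * d i) * coeff d φ := by
  induction φ using MvPolynomial.monomial_add_induction_on with
  | C a =>
    rw [← monomial_zero', scaleDer_monomial, coeff_smul, coeff_monomial]
    split_ifs with h
    · subst h
      simp
    · simp
  | monomial_add s r f _ _ ih =>
    rw [map_add, coeff_add, ih, coeff_add, mul_add, scaleDer_monomial, coeff_smul, coeff_monomial]
    split_ifs with h
    · subst h
      simp
    · simp

lemma scaleDer_eq_smul_iff {σ : Type*} [Fintype σ] (c : σ → ℚ) (φ : MvPolynomial σ ℚ) (μ : ℚ) :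
    scaleDer c φ = μ • φ ↔ ∀ d, coeff d φ ≠ 0 → ∑ i, c i * d i = μ := by
  rw [MvPolynomial.ext_iff]
  refine forall_congr' fun d => ?_
  rw [coeff_scaleDer, coeff_smul, smul_eq_mul, ← sub_eq_zero, ← sub_mul, mul_eq_zero, sub_eq_zero]
  tauto

variable (N) in
/-- The `i`-th variable, or zero if the index is out of range. -/
noncomputable def natVar (i : ℕ) : MvPolynomial (Fin (N + 1)) ℚ :=
  if h : i < N + 1 then X ⟨i, h⟩ else 0

lemma natVar_coe (i : Fin (N + 1)) : natVar N i = X i := by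
  simp [natVar, show (i : ℕ) < N + 1 from i.2]

lemma natVar_eq_zero {i : ℕ} (h : N < i) : natVar N i = 0 := by
  simp [natVar, show ¬ i < N + 1 by omega]

lemma derivation_natVar (D : Derivation ℚ (MvPolynomial (Fin (N + 1)) ℚ)
    (MvPolynomial (Fin (N + 1)) ℚ)) (f : ℕ → MvPolynomial (Fin (N + 1)) ℚ)
    (h : ∀ i : Fin (N + 1), D (X i) = f i) (h0 : ∀ i, N < i → f i = 0) (i : ℕ) :
    D (natVar N i) = f i := by
  rcases Nat.lt_or_ge N i with hi | hi
  · rw [natVar_eq_zero hi, map_zero, h0 i hi]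
  · have := h ⟨i, Nat.lt_succ_of_le hi⟩
    rwa [← natVar_coe] at this

lemma scaleDer_natVar (c : ℕ → ℚ) (i : ℕ) :
    scaleDer (fun i : Fin (N + 1) => c i) (natVar N i) = c i • natVar N i :=
  derivation_natVar _ (fun i => c i • natVar N i)
    (fun i => by rw [scaleDer, mkDerivation_X, natVar_coe])
    (fun i hi => by simp [natVar_eq_zero hi]) i

variable (N) in
/-- The raising operator of the representation of `sl₂` on polynomials. -/
noncomputable def raiseDer :
    Derivation ℚ (MvPolynomial (Fin (N + 1)) ℚ) (MvPolynomial (Fin (N + 1)) ℚ) :=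
  mkDerivation ℚ fun i => natVar N (i + 1)

variable (N) in
/-- The lowering operator of the representation of `sl₂` on polynomials. -/
noncomputable def lowerDer :
    Derivation ℚ (MvPolynomial (Fin (N + 1)) ℚ) (MvPolynomial (Fin (N + 1)) ℚ) :=
  mkDerivation ℚ fun i => (i * (N + 1 - i) : ℚ) • natVar N (i - 1)

lemma raiseDer_natVar (i : ℕ) : raiseDer N (natVar N i) = natVar N (i + 1) :=
  derivation_natVar _ (fun i => natVar N (i + 1)) (fun i => by rw [raiseDer, mkDerivation_X])
    (fun i hi => natVar_eq_zero (by omega)) i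

lemma lowerDer_natVar (i : ℕ) :
    lowerDer N (natVar N i) = (i * (N + 1 - i) : ℚ) • natVar N (i - 1) := by
  refine derivation_natVar _ (fun i => (i * (N + 1 - i) : ℚ) • natVar N (i - 1))
    (fun i => by rw [lowerDer, mkDerivation_X]) (fun i hi => ?_) i
  rcases Nat.eq_or_lt_of_le (Nat.succ_le_of_lt hi) with h | h
  · simp [← h]
  · rw [natVar_eq_zero (by omega), smul_zero]

lemma derivation_eq_of_natVar {D D' : Derivation ℚ (MvPolynomial (Fin (N + 1)) ℚ)
    (MvPolynomial (Fin (N + 1)) ℚ)} (h : ∀ i, D (natVar N i) = D' (natVar N i)) : D = D' :=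
  derivation_ext fun i => by simpa only [natVar_coe] using h i

lemma lie_raiseDer_lowerDer :
    ⁅raiseDer N, lowerDer N⁆ = scaleDer fun i : Fin (N + 1) => (2 * (i : ℕ) - N : ℚ) := by
  refine derivation_eq_of_natVar fun i => ?_
  rw [Derivation.commutator_apply, scaleDer_natVar (fun i => 2 * (i : ℚ) - N), raiseDer_natVar,
    lowerDer_natVar, lowerDer_natVar, Derivation.map_smul, raiseDer_natVar]
  cases i with
  | zero => simp
  | succ i =>
    simp only [Nat.add_sub_cancel]
    rw [← sub_smul]
    congr 1
    push_cast
    ring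

lemma lie_scaleDer_raiseDer (c : ℕ → ℚ) (e : ℚ) (hc : ∀ i, c (i + 1) = c i + e) :
    ⁅scaleDer fun i : Fin (N + 1) => c i, raiseDer N⁆ = e • raiseDer N := by
  refine derivation_eq_of_natVar fun i => ?_
  rw [Derivation.commutator_apply, Derivation.smul_apply, scaleDer_natVar, raiseDer_natVar,
    scaleDer_natVar, Derivation.map_smul, raiseDer_natVar, hc, ← sub_smul, add_sub_cancel_left]

lemma lie_scaleDer_lowerDer (c : ℕ → ℚ) (e : ℚ) (hc : ∀ i, c (i + 1) = c i + e) :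
    ⁅scaleDer fun i : Fin (N + 1) => c i, lowerDer N⁆ = -e • lowerDer N := by
  refine derivation_eq_of_natVar fun i => ?_
  rw [Derivation.commutator_apply, Derivation.smul_apply, scaleDer_natVar, lowerDer_natVar,
    Derivation.map_smul, scaleDer_natVar, Derivation.map_smul, lowerDer_natVar]
  cases i with
  | zero => simp
  | succ i =>
    simp only [Nat.add_sub_cancel]
    rw [hc, smul_smul, smul_smul, smul_smul, ← sub_smul]
    congr 1
    ring

lemma apply_eq_add_smul_of_lie_eq {A : Type*} [CommRing A] [Algebra ℚ A] {D E : Derivation ℚ A A}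
    {e μ : ℚ} {x : A} (h : ⁅D, E⁆ = e • E) (hx : D x = μ • x) : D (E x) = (μ + e) • E x := by
  have := congrArg (fun F : Derivation ℚ A A => F x) h
  simp only [Derivation.commutator_apply, Derivation.smul_apply, hx, Derivation.map_smul] at this
  rw [sub_eq_iff_eq_add] at this
  rw [this, ← add_smul, add_comm]

/-- A lowest-weight argument: a vector of negative weight killed by the raising operator and by
a power of the lowering operator is zero. -/
lemma eq_zero_of_lie_eq {A : Type*} [CommRing A] [Algebra ℚ A] {E F H : Derivation ℚ A A}
    (hEF : ⁅E, F⁆ = H) (hHF : ⁅H, F⁆ = (-2 : ℚ) • F) {μ : ℚ} (hμ : μ < 0) {x : A}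
    (hH : H x = μ • x) (hE : E x = 0) {m : ℕ} (hF : F^[m] x = 0) : x = 0 := by
  have hw : ∀ j : ℕ, H (F^[j] x) = (μ - 2 * j) • F^[j] x := fun j => by
    induction j with
    | zero => simpa using hH
    | succ j ih =>
      rw [Function.iterate_succ_apply', apply_eq_add_smul_of_lie_eq hHF ih]
      congr 1
      push_cast
      ring
  have he : ∀ j : ℕ, E (F^[j + 1] x) = ((j + 1) * (μ - j) : ℚ) • F^[j] x := fun j => by
    have hc : ∀ y, E (F y) = H y + F (E y) := fun y => by
      rw [← hEF, Derivation.commutator_apply, sub_add_cancel]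
    induction j with
    | zero => simp [hc, hH, hE]
    | succ j ih =>
      rw [Function.iterate_succ_apply', hc, hw, ih, Derivation.map_smul,
        ← Function.iterate_succ_apply' F, ← add_smul]
      congr 1
      push_cast
      ring
  induction m with
  | zero => exact hF
  | succ m ih =>
    refine ih ?_
    have h := he m
    rw [hF, map_zero] at h
    refine (smul_eq_zero.1 h.symm).resolve_left (mul_ne_zero (by positivity) ?_)
    have : (0 : ℚ) ≤ m := by positivity
    linarith

variable (N) in
/-- Exponent vectors of degree `b` and weight `r`, where the `i`-th variable has weight `i`. -/
def weightExponents (b r : ℕ) : Finset (Fin (N + 1) → ℕ) :=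
  (Finset.Nat.antidiagonalTuple (N + 1) b).filter fun d => ∑ i : Fin (N + 1), (i : ℕ) * d i = r

lemma mem_weightExponents {b r : ℕ} {d : Fin (N + 1) → ℕ} :
    d ∈ weightExponents N b r ↔ ∑ i, d i = b ∧ ∑ i : Fin (N + 1), (i : ℕ) * d i = r := by
  rw [weightExponents, Finset.mem_filter, Finset.Nat.mem_antidiagonalTuple]

variable (N) in
/-- The weight spaces of the representation. -/
noncomputable def weightSpace (b r : ℕ) : Submodule ℚ (MvPolynomial (Fin (N + 1)) ℚ) :=
  restrictSupport ℚ {d | ⇑d ∈ weightExponents N b r}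

lemma mem_weightSpace {b r : ℕ} {φ : MvPolynomial (Fin (N + 1)) ℚ} :
    φ ∈ weightSpace N b r ↔ scaleDer (fun _ => 1) φ = (b : ℚ) • φ ∧
      scaleDer (fun i : Fin (N + 1) => ((i : ℕ) : ℚ)) φ = (r : ℚ) • φ := by
  rw [weightSpace, mem_restrictSupport_iff, scaleDer_eq_smul_iff, scaleDer_eq_smul_iff,
    ← forall_and, Set.subset_def]
  refine forall_congr' fun d => ?_
  rw [Finset.mem_coe, mem_support_iff, Set.mem_ofPred_eq, mem_weightExponents, imp_and]
  refine and_congr (imp_congr_right fun _ => ?_) (imp_congr_right fun _ => ?_)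
  · simp only [one_mul]
    norm_cast
  · norm_cast

lemma finrank_weightSpace (b r : ℕ) :
    Module.finrank ℚ (weightSpace N b r) = (weightExponents N b r).card := by
  rw [weightSpace, Module.finrank_eq_nat_card_basis (basisRestrictSupport ℚ _),
    ← Fintype.card_coe, ← Nat.card_eq_fintype_card]
  exact Nat.card_congr (Finsupp.equivFunOnFinite.subtypeEquiv fun d => Iff.rfl)

instance (b r : ℕ) : Module.Finite ℚ (weightSpace N b r) := by
  have : Finite {d : Fin (N + 1) →₀ ℕ | ⇑d ∈ weightExponents N b r} :=
    .of_injective (β := weightExponents N b r) (fun d => ⟨d.1, d.2⟩)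
      fun d e h => Subtype.ext (DFunLike.coe_injective (congrArg Subtype.val h))
  exact Module.Finite.of_basis (basisRestrictSupport ℚ _)

lemma card_weightExponents_le_succ {b r : ℕ} (h : 2 * r < N * b) :
    (weightExponents N b r).card ≤ (weightExponents N b (r + 1)).card := by
  have hmap : ∀ φ ∈ weightSpace N b r, raiseDer N φ ∈ weightSpace N b (r + 1) := fun φ hφ => by
    rw [mem_weightSpace] at hφ ⊢
    constructor
    · simpa using apply_eq_add_smul_of_lie_eq
        (lie_scaleDer_raiseDer (fun _ => 1) 0 (by simp)) hφ.1
    · simpa using apply_eq_add_smul_of_lie_eq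
        (lie_scaleDer_raiseDer (fun i => (i : ℚ)) 1 (by simp)) hφ.2
  rw [← finrank_weightSpace, ← finrank_weightSpace]
  refine LinearMap.finrank_le_finrank_of_injective
    (f := (raiseDer N : MvPolynomial (Fin (N + 1)) ℚ →ₗ[ℚ] _).restrict hmap) ?_
  rw [← LinearMap.ker_eq_bot, LinearMap.ker_eq_bot']
  rintro ⟨φ, hφ⟩ h0
  have hE : raiseDer N φ = 0 := congrArg Subtype.val h0
  rw [mem_weightSpace] at hφ
  have hw : ∀ j : ℕ, scaleDer (fun i : Fin (N + 1) => ((i : ℕ) : ℚ)) ((lowerDer N)^[j] φ) =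
      (r - j : ℚ) • (lowerDer N)^[j] φ := fun j => by
    induction j with
    | zero => simpa using hφ.2
    | succ j ih =>
      rw [Function.iterate_succ_apply', apply_eq_add_smul_of_lie_eq
        (lie_scaleDer_lowerDer (fun i => (i : ℚ)) 1 (by simp)) ih]
      congr 1
      push_cast
      ring
  have hF : (lowerDer N)^[r + 1] φ = 0 := by
    have := (scaleDer_eq_smul_iff _ _ _).1 (hw (r + 1))
    by_contra hne
    obtain ⟨d, hd⟩ := exists_coeff_ne_zero hne
    have h1 := this d hd
    have h2 : (0 : ℚ) ≤ ∑ i : Fin (N + 1), ((i : ℕ) : ℚ) * d i :=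
      Finset.sum_nonneg fun i _ => by positivity
    push_cast at h1
    linarith
  have hH : scaleDer (fun i : Fin (N + 1) => (2 * (i : ℕ) - N : ℚ)) φ =
      (2 * r - N * b : ℚ) • φ := by
    rw [scaleDer_eq_smul_iff] at hφ ⊢
    rw [scaleDer_eq_smul_iff] at hφ
    intro d hd
    rw [← hφ.1 d hd, ← hφ.2 d hd, Finset.mul_sum, Finset.mul_sum, ← Finset.sum_sub_distrib]
    exact Finset.sum_congr rfl fun i _ => by ring
  refine Subtype.ext (eq_zero_of_lie_eq lie_raiseDer_lowerDer
    (lie_scaleDer_lowerDer (fun i => 2 * (i : ℚ) - N) 2 fun i => by push_cast; ring)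
    (μ := 2 * r - N * b) ?_ hH hE hF)
  have : (2 * r : ℚ) < N * b := by exact_mod_cast h
  linarith

lemma card_weightExponents_rev {b r : ℕ} (h : r ≤ N * b) :
    (weightExponents N b r).card = (weightExponents N b (N * b - r)).card := by
  have key : ∀ d : Fin (N + 1) → ℕ,
      ∑ i : Fin (N + 1), (i : ℕ) * d i.rev + ∑ i : Fin (N + 1), (i : ℕ) * d i =
        N * ∑ i, d i := fun d => by
    rw [← Equiv.sum_comp Fin.revPerm, ← Finset.sum_add_distrib, Finset.mul_sum]
    refine Finset.sum_congr rfl fun i _ => ?_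
    rw [Fin.revPerm_apply, Fin.rev_rev, ← add_mul, Fin.val_rev]
    congr 1
    omega
  refine Finset.card_bij' (fun d _ => d ∘ Fin.rev) (fun d _ => d ∘ Fin.rev) ?_ ?_ ?_ ?_
  · intro d hd
    rw [mem_weightExponents] at hd ⊢
    have hk := key d
    rw [hd.1, hd.2] at hk
    exact ⟨(Equiv.sum_comp Fin.revPerm d).trans hd.1, by simp only [Function.comp_apply]; omega⟩
  · intro d hd
    rw [mem_weightExponents] at hd ⊢
    have hk := key d
    rw [hd.1, hd.2] at hk
    exact ⟨(Equiv.sum_comp Fin.revPerm d).trans hd.1, by simp only [Function.comp_apply]; omega⟩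
  · intro d _
    ext i
    simp
  · intro d _
    ext i
    simp

lemma weightExponents_eq_empty {b r : ℕ} (h : N * b < r) : weightExponents N b r = ∅ := by
  refine Finset.eq_empty_of_forall_notMem fun d hd => ?_
  rw [mem_weightExponents] at hd
  rw [← hd.1, ← hd.2, Finset.mul_sum] at h
  exact absurd h (not_lt.2 (Finset.sum_le_sum fun i _ =>
    Nat.mul_le_mul_right _ (Nat.lt_succ_iff.1 i.2)))

end SlTwo

section QBinomialUnimodal

open Polynomial

lemma sum_antidiagonalTuple_succ {M : Type*} [AddCommMonoid M] (k n : ℕ)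
    (f : (Fin (k + 1) → ℕ) → M) :
    ∑ d ∈ Finset.Nat.antidiagonalTuple (k + 1) n, f d =
      ∑ p ∈ antidiagonal n, ∑ d ∈ Finset.Nat.antidiagonalTuple k p.2, f (Fin.cons p.1 d) := by
  rw [Finset.sum_sigma']
  refine Finset.sum_bij' (fun d _ => ⟨(d 0, ∑ i, Fin.tail d i), Fin.tail d⟩)
    (fun x _ => Fin.cons x.1.1 x.2) ?_ ?_ ?_ ?_ ?_
  · intro d hd
    rw [Finset.Nat.mem_antidiagonalTuple, Fin.sum_univ_succ] at hd
    simpa [Finset.Nat.mem_antidiagonalTuple, Fin.tail] using hd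
  · rintro ⟨⟨a, b⟩, d⟩ hd
    simp only [Finset.mem_sigma, HasAntidiagonal.mem_antidiagonal,
      Finset.Nat.mem_antidiagonalTuple] at hd
    simp [Finset.Nat.mem_antidiagonalTuple, Fin.sum_univ_succ, hd.1, hd.2]
  · intro d _
    simp
  · rintro ⟨⟨a, b⟩, d⟩ hd
    simp only [Finset.mem_sigma, HasAntidiagonal.mem_antidiagonal,
      Finset.Nat.mem_antidiagonalTuple] at hd
    simp [hd.2]
  · intro d _
    simp

lemma sum_antidiagonalTuple_pow {R : Type*} [CommSemiring R] (q : R) (N b : ℕ) :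
    ∑ d ∈ Finset.Nat.antidiagonalTuple (N + 1) b, q ^ (∑ i : Fin (N + 1), (i : ℕ) * d i) =
      qBinom q (N + b) b := by
  induction N generalizing b with
  | zero => simp
  | succ N ih =>
    have key : ∀ b, ∑ d ∈ Finset.Nat.antidiagonalTuple (N + 1 + 1) b,
        q ^ (∑ i : Fin (N + 1 + 1), (i : ℕ) * d i) =
          ∑ p ∈ antidiagonal b, q ^ p.2 * qBinom q (N + p.2) p.2 := fun b => by
      rw [sum_antidiagonalTuple_succ]
      refine Finset.sum_congr rfl fun p _ => ?_
      rw [← ih, Finset.mul_sum]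
      refine Finset.sum_congr rfl fun d hd => ?_
      rw [Finset.Nat.mem_antidiagonalTuple] at hd
      rw [Fin.sum_univ_succ]
      simp only [Fin.val_zero, zero_mul, zero_add, Fin.cons_succ, Fin.val_succ, add_mul, one_mul,
        Finset.sum_add_distrib, hd]
      rw [pow_add, mul_comm]
    rw [key]
    induction b with
    | zero => simp
    | succ b ihb =>
      rw [Finset.Nat.sum_antidiagonal_succ, ihb, show N + 1 + (b + 1) = N + (b + 1) + 1 by ring,
        qBinom_succ_succ, show N + (b + 1) = N + 1 + b by ring]
      ring

lemma coeff_qBinom_X (N b r : ℕ) :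
    (qBinom (X : ℕ[X]) (N + b) b).coeff r = (weightExponents N b r).card := by
  rw [← sum_antidiagonalTuple_pow, finsetSum_coeff, weightExponents, Finset.card_filter]
  exact Finset.sum_congr rfl fun d _ => by rw [coeff_X_pow]; simp only [eq_comm]

lemma symmUnimodal_qBinom (n k : ℕ) : SymmUnimodal (qBinom (X : ℕ[X]) n k) ((n - k) * k) := by
  rcases Nat.lt_or_ge n k with h | h
  · rw [qBinom_eq_zero_of_lt _ h]
    exact SymmUnimodal.zero _
  · obtain ⟨N, rfl⟩ := Nat.exists_eq_add_of_le' h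
    rw [Nat.add_sub_cancel]
    refine ⟨fun i hi => ?_, fun i hi => ?_, fun i hi => ?_⟩
    · rw [coeff_qBinom_X, coeff_qBinom_X, card_weightExponents_rev hi]
    · rw [coeff_qBinom_X, weightExponents_eq_empty hi, Finset.card_empty]
    · rw [coeff_qBinom_X, coeff_qBinom_X]
      exact card_weightExponents_le_succ hi

end QBinomialUnimodal

section LetterInsertion

open PowerSeries

variable {R S : Type*}

/-- The coefficients obtained from `A` (attached to words of length `n`) by inserting `s` copies
of a new letter. -/
def insertLetter [CommSemiring R] (q : R) (n s : ℕ) (A : ℕ → R) (l : ℕ) : R :=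
  ∑ p ∈ antidiagonal l, q ^ (p.2 * l) * qBinom q (n - p.1) p.2 * qBinom q (s + p.1) l * A p.1

lemma map_insertLetter [CommSemiring R] [CommSemiring S] (f : R →+* S) (q : R) (n s : ℕ)
    (A : ℕ → R) (l : ℕ) :
    f (insertLetter q n s A l) = insertLetter (f q) n s (fun k => f (A k)) l := by
  simp [insertLetter, map_qBinom]

lemma insertLetter_eq_zero [CommSemiring R] (q : R) {n s : ℕ} {A : ℕ → R}
    (hA : ∀ k, n < k → A k = 0) {l : ℕ} (hl : n + s < l) : insertLetter q n s A l = 0 := by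
  refine Finset.sum_eq_zero fun p _ => ?_
  rcases Nat.lt_or_ge n p.1 with h | h
  · rw [hA _ h, mul_zero]
  · rw [qBinom_eq_zero_of_lt q (by omega : s + p.1 < l), mul_zero, zero_mul]

lemma insertLetter_zero [CommSemiring R] (q : R) (n : ℕ) (A : ℕ → R) :
    insertLetter q n 0 A = A := by
  ext l
  rw [insertLetter, Finset.sum_eq_single (l, 0)]
  · simp
  · rintro ⟨i, j⟩ hp hne
    rw [HasAntidiagonal.mem_antidiagonal] at hp
    have : j ≠ 0 := fun h => hne (by subst h; simpa using hp)
    dsimp only at hp ⊢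
    rw [qBinom_eq_zero_of_lt q (by omega : 0 + i < l), mul_zero, zero_mul]
  · simp

section CommRing

variable [CommRing R] (q : R)

lemma one_sub_pow_mul_qBinom_add (l e j : ℕ) :
    (1 - q ^ (e + j)) * qBinom q (l + e + 1) (l + 1) =
      (1 - q ^ (e + j + l + 1)) * qBinom q (l + e) (l + 1) +
        q ^ e * (1 - q ^ j) * qBinom q (l + e) l := by
  have h2 := qBinom_succ_succ' q (l + e) l
  have h3 := one_sub_pow_mul_qBinom_succ q (l + e) l
  rw [Nat.add_sub_cancel_left] at h2 h3
  linear_combination (1 - q ^ (e + j)) * h2 - q ^ (e + j) * h3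

lemma insertLetter_succ_zero (n s : ℕ) (A : ℕ → R) :
    (1 - q ^ (s + 1)) * insertLetter q n (s + 1) A 0 =
      (1 - q ^ (s + 1)) * insertLetter q n s A 0 := by
  simp [insertLetter]

lemma insertLetter_succ_succ {n : ℕ} (s : ℕ) {A : ℕ → R} (hA : ∀ k, n < k → A k = 0) (l : ℕ) :
    (1 - q ^ (s + 1)) * insertLetter q n (s + 1) A (l + 1) =
      (1 - q ^ (s + 1 + (l + 1))) * insertLetter q n s A (l + 1) +
        (q ^ (s + 1 + l) - q ^ (n + s + 1)) * insertLetter q n s A l := by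
  unfold insertLetter
  rw [Finset.Nat.sum_antidiagonal_succ', Finset.Nat.sum_antidiagonal_succ',
    mul_add (1 - q ^ (s + 1)), mul_add (1 - q ^ (s + 1 + (l + 1))), Finset.mul_sum,
    Finset.mul_sum, Finset.mul_sum]
  refine (congrArg₂ (· + ·) ?_ ?_).trans (add_assoc _ _ _).symm
  · have h2 := one_sub_pow_mul_qBinom_add q l (s + 1) 0
    simp only [zero_mul, pow_zero, qBinom_zero_right, one_mul]
    rw [show s + 1 + (l + 1) = l + (s + 1) + 1 by ring, show s + (l + 1) = l + (s + 1) by ring]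
    linear_combination A (l + 1) * h2
  · rw [← Finset.sum_add_distrib]
    refine Finset.sum_congr rfl ?_
    rintro ⟨k, j⟩ hp
    rw [HasAntidiagonal.mem_antidiagonal] at hp
    dsimp only at hp ⊢
    rcases Nat.lt_or_ge n k with hk | hk
    · simp [hA k hk]
    rcases Nat.lt_or_ge (n - k) j with hj | hj
    · rw [qBinom_eq_zero_of_lt q hj, qBinom_eq_zero_of_lt q (by omega : n - k < j + 1)]
      ring
    rcases Nat.lt_or_ge s j with hs | hs
    · rw [qBinom_eq_zero_of_lt q (by omega : s + 1 + k < l + 1),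
        qBinom_eq_zero_of_lt q (by omega : s + k < l + 1),
        qBinom_eq_zero_of_lt q (by omega : s + k < l)]
      ring
    obtain ⟨e, rfl⟩ := Nat.exists_eq_add_of_le hs
    obtain ⟨f, hf⟩ := Nat.exists_eq_add_of_le hj
    obtain rfl : n = k + j + f := by omega
    have h1 := one_sub_pow_mul_qBinom_succ q (k + j + f - k) j
    have h2 := one_sub_pow_mul_qBinom_add q l e (j + 1)
    rw [show k + j + f - k - j = f by omega] at h1
    subst hp
    rw [show j + e + 1 + k = k + j + e + 1 by ring, show j + e + k = k + j + e by ring]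
    linear_combination q ^ ((j + 1) * (k + j + 1)) * qBinom q (k + j + f - k) (j + 1) * A k * h2 +
      q ^ ((j + 1) * (k + j + 1) + e) * qBinom q (k + j + e) (k + j) * A k * h1

/-- The `q`-Pochhammer product `(1 - x)(1 - q x) ⋯ (1 - q ^ (n - 1) x)`. -/
noncomputable def qPochhammer (n : ℕ) : R⟦X⟧ := ∏ i ∈ range n, (1 - C (q ^ i) * X)

lemma qPochhammer_succ (n : ℕ) :
    qPochhammer q (n + 1) = qPochhammer q n * (1 - C (q ^ n) * X) :=
  Finset.prod_range_succ _ _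

lemma qPochhammer_one_mul_mk_one : qPochhammer q 1 * PowerSeries.mk (fun _ => 1) = 1 := by
  rw [qPochhammer, Finset.prod_range_one, pow_zero, map_one, one_mul, mul_comm]
  exact PowerSeries.mk_one_mul_one_sub_eq_one R

lemma rescale_C (a : R) : rescale q (C a) = C a := by
  ext m
  rw [coeff_rescale, coeff_C]
  split_ifs with h <;> simp [h]

lemma rescale_qPochhammer_mul (n : ℕ) :
    rescale q (qPochhammer q n) * (1 - X) = qPochhammer q (n + 1) := by
  rw [qPochhammer, qPochhammer, Finset.prod_range_succ', map_prod]
  congr 1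
  · refine Finset.prod_congr rfl fun i _ => ?_
    rw [map_sub, map_one, map_mul, rescale_X, ← mul_assoc, rescale_C, ← map_mul, pow_succ]
  · simp

lemma qPochhammer_mul_mk_one_sub_pow {n : ℕ} {c A : ℕ → R}
    (h : qPochhammer q (n + 1) * PowerSeries.mk c = PowerSeries.mk A) (s : ℕ) :
    qPochhammer q (n + 2) * PowerSeries.mk (fun m => (1 - q ^ (m + s)) * c m) =
      (1 - C (q ^ (n + 1)) * X) * PowerSeries.mk A -
        C (q ^ s) * ((1 - X) * rescale q (PowerSeries.mk A)) := by
  have h1 : PowerSeries.mk (fun m => (1 - q ^ (m + s)) * c m) =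
      PowerSeries.mk c - C (q ^ s) * rescale q (PowerSeries.mk c) := by
    ext m
    rw [map_sub, coeff_C_mul, coeff_rescale, coeff_mk, coeff_mk]
    ring
  rw [h1, ← h, map_mul]
  have h2 := rescale_qPochhammer_mul q (n + 1)
  have h3 := qPochhammer_succ q (n + 1)
  linear_combination PowerSeries.mk c * h3 + C (q ^ s) * rescale q (PowerSeries.mk c) * h2

lemma qPochhammer_mul_mk_qBinom_mul [IsDomain R] (hq : ∀ j, q ^ (j + 1) ≠ 1) {n : ℕ}
    {c A : ℕ → R} (hA : ∀ k, n < k → A k = 0)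
    (h : qPochhammer q (n + 1) * PowerSeries.mk c = PowerSeries.mk A) (s : ℕ) :
    qPochhammer q (n + s + 1) * PowerSeries.mk (fun m => qBinom q (m + s) s * c m) =
      PowerSeries.mk (insertLetter q n s A) := by
  induction s with
  | zero => simpa [insertLetter_zero] using h
  | succ s ih =>
    have hne : C (1 - q ^ (s + 1)) ≠ 0 := by
      rw [Ne, map_eq_zero_iff _ PowerSeries.C_injective, sub_eq_zero]
      exact (hq s).symm
    refine mul_left_cancel₀ hne ?_
    have h1 : C (1 - q ^ (s + 1)) * PowerSeries.mk (fun m => qBinom q (m + (s + 1)) (s + 1) * c m) =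
        PowerSeries.mk (fun m => (1 - q ^ (m + (s + 1))) * (qBinom q (m + s) s * c m)) := by
      ext m
      rw [coeff_C_mul, coeff_mk, coeff_mk]
      linear_combination c m * one_sub_pow_mul_qBinom_succ_succ q (m + s) s
    rw [mul_left_comm, h1, show n + (s + 1) + 1 = n + s + 2 by ring,
      qPochhammer_mul_mk_one_sub_pow q ih]
    ext l
    rw [coeff_C_mul, coeff_mk]
    simp only [sub_mul (1 : R⟦X⟧), one_mul, mul_assoc, map_sub, coeff_C_mul, coeff_mk]
    cases l with
    | zero =>
      simp only [coeff_zero_X_mul, coeff_rescale, coeff_mk]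
      linear_combination -insertLetter_succ_zero q n s A
    | succ l =>
      simp only [coeff_succ_X_mul, coeff_rescale, coeff_mk]
      linear_combination -insertLetter_succ_succ q s hA l

end CommRing

lemma symmUnimodal_insertLetter {n s : ℕ} {A : ℕ → Polynomial ℕ}
    (hA : ∀ k, SymmUnimodal (A k) (n * k)) (l : ℕ) :
    SymmUnimodal (insertLetter Polynomial.X n s A l) ((n + s) * l) := by
  refine SymmUnimodal.sum ?_
  rintro ⟨k, j⟩ hp
  rw [HasAntidiagonal.mem_antidiagonal] at hp
  dsimp only at hp ⊢
  rcases Nat.lt_or_ge (n - k) j with hj | hj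
  · rw [qBinom_eq_zero_of_lt _ hj, mul_zero, zero_mul, zero_mul]
    exact SymmUnimodal.zero _
  rcases Nat.lt_or_ge (s + k) l with hl | hl
  · rw [qBinom_eq_zero_of_lt _ hl, mul_zero, zero_mul]
    exact SymmUnimodal.zero _
  convert ((((symmUnimodal_qBinom (n - k) j).X_pow_mul (j * l)).mul
    (symmUnimodal_qBinom (s + k) l)).mul (hA k)) using 1
  rcases Nat.lt_or_ge n k with hk | hk
  · obtain rfl : j = 0 := by omega
    obtain rfl : k = l := hp
    rw [Nat.add_sub_cancel]
    ring
  · obtain ⟨f, hf⟩ := Nat.exists_eq_add_of_le hj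
    obtain ⟨e, he⟩ := Nat.exists_eq_add_of_le hl
    obtain rfl : n = k + j + f := by omega
    obtain rfl : s = j + e := by omega
    subst hp
    rw [show k + j + f - k - j = f by omega, show j + e + k - (k + j) = e by omega]
    ring

end LetterInsertion

section MacMahon

open PowerSeries

lemma exists_symmUnimodal_numerator (t : ℕ) (v : Fin t → ℕ) :
    ∃ A : ℕ → Polynomial ℕ, (∀ k, SymmUnimodal (A k) ((∑ i, v i) * k)) ∧
      (∀ k, ∑ i, v i < k → A k = 0) ∧
      qPochhammer (Polynomial.X : Polynomial ℤ) (∑ i, v i + 1) *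
          PowerSeries.mk (fun m => ∏ i, qBinom Polynomial.X (m + v i) (v i)) =
        PowerSeries.mk fun k => (A k).map (Nat.castRingHom ℤ) := by
  induction t with
  | zero =>
    refine ⟨fun k => if k = 0 then 1 else 0, fun k => ?_, fun k hk => ?_, ?_⟩
    · dsimp only
      split_ifs
      · simpa [qInterval] using symmUnimodal_qInterval 0
      · exact SymmUnimodal.zero _
    · exact if_neg (Nat.ne_zero_of_lt hk)
    · simp only [Finset.univ_eq_empty, Finset.sum_empty, Finset.prod_empty, zero_add,
        qPochhammer_one_mul_mk_one]
      ext1 k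
      rw [coeff_one, coeff_mk]
      split_ifs <;> simp
  | succ t ih =>
    obtain ⟨A, hA, hA0, h⟩ := ih (fun i => v i.castSucc)
    have hq : ∀ j, (Polynomial.X : Polynomial ℤ) ^ (j + 1) ≠ 1 := fun j hj => by
      have := congrArg Polynomial.natDegree hj
      simp at this
    refine ⟨insertLetter Polynomial.X (∑ i : Fin t, v i.castSucc) (v (Fin.last t)) A,
      fun k => ?_, fun k hk => ?_, ?_⟩
    · rw [Fin.sum_univ_castSucc]
      exact symmUnimodal_insertLetter hA k
    · rw [Fin.sum_univ_castSucc] at hk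
      exact insertLetter_eq_zero _ hA0 hk
    · have key := qPochhammer_mul_mk_qBinom_mul Polynomial.X hq
        (fun k hk => by rw [hA0 k hk, Polynomial.map_zero]) h (v (Fin.last t))
      simp only [Fin.sum_univ_castSucc, Fin.prod_univ_castSucc]
      simp only [mul_comm (∏ _, _)]
      rw [key]
      congr 1
      ext1 k
      have := map_insertLetter (Polynomial.mapRingHom (Nat.castRingHom ℤ)) Polynomial.X
        (∑ i : Fin t, v i.castSucc) (v (Fin.last t)) A k
      simpa using this.symm

lemma sum_wDescSet_snoc {M : Type*} [AddCommMonoid M] {n t : ℕ} (w : Fin (n + 1) → Fin t)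
    (a : Fin t) (f : ℕ → M) :
    ∑ i ∈ wDescSet (Fin.snoc w a : Fin (n + 2) → Fin t), f i =
      ∑ i ∈ wDescSet w, f i + if a < w (Fin.last n) then f n else 0 := by
  have hlast : (⟨n + 1, by omega⟩ : Fin (n + 2)) = Fin.last (n + 1) := rfl
  have hcast : ∀ i : ℕ, ∀ h : i < n + 1,
      (⟨i, by omega⟩ : Fin (n + 2)) = Fin.castSucc ⟨i, h⟩ := fun _ _ => rfl
  have hend : (Fin.snoc w a : Fin (n + 2) → Fin t) (Fin.last n).castSucc = w (Fin.last n) :=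
    Fin.snoc_castSucc (α := fun _ => Fin t) a w (Fin.last n)
  rw [wDescSet, wDescSet, Finset.sum_filter, Finset.sum_filter, Fin.sum_univ_castSucc,
    Fin.sum_univ_castSucc, Fin.sum_univ_castSucc]
  simp only [Fin.val_castSucc, Fin.val_last, lt_irrefl, IsEmpty.exists_iff, if_false, add_zero,
    hlast, hend, Fin.snoc_last, Nat.lt_succ_self, exists_true_left]
  congr 1
  refine Finset.sum_congr rfl fun i _ => if_congr ?_ rfl rfl
  have hi := i.2
  have h1 := Fin.snoc_castSucc (α := fun _ => Fin t) a w ⟨i + 1, by omega⟩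
  have h2 := Fin.snoc_castSucc (α := fun _ => Fin t) a w i.castSucc
  simp only [Fin.castSucc_mk] at h1
  simp only [h2, h1]
  constructor
  · rintro ⟨_, h⟩
    exact ⟨by omega, h⟩
  · rintro ⟨_, h⟩
    exact ⟨by omega, h⟩

lemma card_filter_snoc {n t : ℕ} (w : Fin n → Fin t) (b a : Fin t) :
    (Finset.univ.filter fun i => (Fin.snoc w b : Fin (n + 1) → Fin t) i = a).card =
      (Finset.univ.filter fun i => w i = a).card + if b = a then 1 else 0 := by
  rw [Finset.card_filter, Finset.card_filter, Fin.sum_univ_castSucc]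
  rw [Fin.snoc_last (α := fun _ => Fin t)]
  congr 1
  refine Finset.sum_congr rfl fun i _ => ?_
  rw [Fin.snoc_castSucc (α := fun _ => Fin t)]

lemma snoc_mem_multisetPerms {n t : ℕ} (u : Fin t → ℕ) (w : Fin n → Fin t) (b : Fin t) :
    (Fin.snoc w b : Fin (n + 1) → Fin t) ∈ multisetPerms (n + 1) t u ↔
      u b ≠ 0 ∧ w ∈ multisetPerms n t (u - Pi.single b 1) := by
  simp only [multisetPerms, Finset.mem_filter, Finset.mem_univ, true_and, card_filter_snoc,
    Pi.sub_apply]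
  constructor
  · intro h
    refine ⟨by simp [← h b], fun a => ?_⟩
    rw [← h a]
    rcases eq_or_ne b a with rfl | hne
    · simp
    · simp [hne, hne.symm]
  · rintro ⟨hb, h⟩ a
    rw [h a]
    rcases eq_or_ne b a with rfl | hne
    · simp only [Pi.single_eq_same, if_true]
      omega
    · simp [hne, hne.symm]

lemma sum_multisetPerms_succ {M : Type*} [AddCommMonoid M] {n t : ℕ} (u : Fin t → ℕ)
    (f : (Fin (n + 1) → Fin t) → M) :
    ∑ w ∈ multisetPerms (n + 1) t u, f w =
      ∑ b, if u b ≠ 0 then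
        ∑ w ∈ multisetPerms n t (u - Pi.single b 1), f (Fin.snoc w b) else 0 := by
  have h1 : ∑ w ∈ multisetPerms (n + 1) t u, f w =
      ∑ w, if w ∈ multisetPerms (n + 1) t u then f w else 0 := by
    rw [← Finset.sum_filter, Finset.filter_mem_eq_inter, Finset.univ_inter]
  rw [h1, ← (Fin.snocEquiv fun _ : Fin (n + 1) => Fin t).sum_comp, Fintype.sum_prod_type]
  refine Finset.sum_congr rfl fun b _ => ?_
  simp only [Fin.snocEquiv, Equiv.coe_fn_mk, snoc_mem_multisetPerms]
  split_ifs with hb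
  · simp only [hb, true_and, ne_eq, not_false_eq_true]
    rw [← Finset.sum_filter, Finset.filter_mem_eq_inter, Finset.univ_inter]
  · simp [hb]

variable {R : Type*} [CommRing R] (q : R)

/-- The monomial `q ^ maj(w) * X ^ des(w)`. -/
noncomputable def wordWeight {n t : ℕ} (w : Fin n → Fin t) : R⟦X⟧ := C (q ^ wMaj w) * X ^ wDes w

lemma wordWeight_snoc {n t : ℕ} (w : Fin (n + 1) → Fin t) (a : Fin t) :
    wordWeight q (Fin.snoc w a : Fin (n + 2) → Fin t) =
      wordWeight q w * if a < w (Fin.last n) then C (q ^ (n + 1)) * X else 1 := by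
  have h1 : wMaj (Fin.snoc w a : Fin (n + 2) → Fin t) = _ :=
    sum_wDescSet_snoc w a (fun i => i + 1)
  have h2 := sum_wDescSet_snoc w a (fun _ => 1)
  rw [← Finset.card_eq_sum_ones, ← Finset.card_eq_sum_ones] at h2
  rw [wordWeight, wordWeight, wDes, h1, h2, wDes, wMaj]
  split_ifs
  · rw [pow_add, pow_add, map_mul]
    ring
  · simp

lemma wordWeight_of_le_one {n t : ℕ} (hn : n ≤ 1) (w : Fin n → Fin t) : wordWeight q w = 1 := by
  have h : wDescSet w = ∅ := by
    rw [wDescSet, Finset.filter_eq_empty_iff]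
    rintro i - ⟨h, -⟩
    omega
  simp [wordWeight, wDes, wMaj, h]

/-- The product of `qBinom q (m + u i) (u i)` over `i`, with the factors for `i ≥ c` replaced by
`q ^ u i * qBinom q (m + u i - 1) (u i)`. -/
def splitQBinomProd {t : ℕ} (u : Fin t → ℕ) (c m : ℕ) : R :=
  ∏ i : Fin t, if (i : ℕ) < c then qBinom q (m + u i) (u i)
    else q ^ u i * qBinom q (m + u i - 1) (u i)

lemma splitQBinomProd_self {t : ℕ} (u : Fin t → ℕ) (m : ℕ) :
    splitQBinomProd q u t m = ∏ i, qBinom q (m + u i) (u i) :=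
  Finset.prod_congr rfl fun i _ => if_pos i.2

lemma mk_splitQBinomProd_zero {t n : ℕ} {u : Fin t → ℕ} (hu : ∑ i, u i = n + 1) :
    PowerSeries.mk (splitQBinomProd q u 0) =
      C (q ^ (n + 1)) * X * PowerSeries.mk (splitQBinomProd q u t) := by
  ext m
  rw [mul_assoc, coeff_C_mul, coeff_mk]
  simp only [splitQBinomProd, Nat.not_lt_zero, if_false]
  cases m with
  | zero =>
    rw [coeff_zero_X_mul, mul_zero]
    obtain ⟨i, -, hi⟩ := Finset.exists_ne_zero_of_sum_ne_zero (hu.trans_ne n.succ_ne_zero)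
    refine Finset.prod_eq_zero (Finset.mem_univ i) ?_
    rw [qBinom_eq_zero_of_lt q (by omega), mul_zero]
  | succ m =>
    rw [coeff_succ_X_mul, coeff_mk, splitQBinomProd_self, Finset.prod_mul_distrib,
      Finset.prod_pow_eq_pow_sum, hu]
    congr 1
    refine Finset.prod_congr rfl fun i _ => ?_
    rw [show m + 1 + u i - 1 = m + u i by omega]

lemma splitQBinomProd_sub {t : ℕ} (u : Fin t → ℕ) (b : Fin t) (m : ℕ) :
    splitQBinomProd q u (b + 1) m - splitQBinomProd q u b m =
      if u b ≠ 0 then splitQBinomProd q (u - Pi.single b 1) (b + 1) m else 0 := by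
  have hsplit : ∀ (u' : Fin t → ℕ) (c : ℕ), (∀ i, i ≠ b → u' i = u i) → (c = b ∨ c = b + 1) →
      splitQBinomProd q u' c m =
        (if (b : ℕ) < c then qBinom q (m + u' b) (u' b)
          else q ^ u' b * qBinom q (m + u' b - 1) (u' b)) *
        ∏ i ∈ univ.erase b, if (i : ℕ) < (b : ℕ) then qBinom q (m + u i) (u i)
          else q ^ u i * qBinom q (m + u i - 1) (u i) := by
    intro u' c hu' hc
    rw [splitQBinomProd, ← Finset.mul_prod_erase univ _ (Finset.mem_univ b)]
    congr 1
    refine Finset.prod_congr rfl fun i hi => ?_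
    have hib := Finset.ne_of_mem_erase hi
    have hib' : (i : ℕ) ≠ b := fun h => hib (Fin.ext h)
    rw [hu' i hib]
    exact if_congr (by omega) rfl rfl
  rw [hsplit u _ (fun _ _ => rfl) (Or.inr rfl), hsplit u _ (fun _ _ => rfl) (Or.inl rfl),
    hsplit (u - Pi.single b 1) _ (fun i hi => by simp [hi]) (Or.inr rfl), ← sub_mul]
  simp only [Nat.lt_succ_self, if_true, lt_irrefl, if_false, Pi.sub_apply, Pi.single_eq_same]
  rcases Nat.eq_zero_or_pos (u b) with h | h
  · simp [h]
  · obtain ⟨k, hk⟩ := Nat.exists_eq_add_of_le' h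
    rw [if_pos h.ne', hk, ← add_assoc, qBinom_succ_succ, Nat.add_sub_cancel, Nat.add_sub_cancel]
    ring

lemma sum_sub_mul_ite {t : ℕ} (F : ℕ → R) (y : R) (a : Fin t) :
    ∑ b : Fin t, (F (b + 1) - F b) * (if a < b then y else 1) =
      F (a + 1) - F 0 + y * (F t - F (a + 1)) := by
  simp only [Fin.lt_def]
  rw [Fin.sum_univ_eq_sum_range (fun b => (F (b + 1) - F b) * (if (a : ℕ) < b then y else 1)) t]
  obtain ⟨d, hd⟩ := Nat.exists_eq_add_of_le (Nat.succ_le_of_lt a.2)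
  generalize (a : ℕ) = c at hd ⊢
  clear a
  subst hd
  induction d with
  | zero =>
    rw [Finset.sum_congr rfl fun b hb => by
      rw [if_neg (by have := Finset.mem_range.1 hb; omega), mul_one], Finset.sum_range_sub]
    simp
  | succ d ih =>
    rw [← add_assoc, Finset.sum_range_succ, ih, if_pos (by omega)]
    ring

lemma sum_wordWeight_snoc {n t : ℕ} {u : Fin t → ℕ} (hu : ∑ i, u i = n) (a : Fin t) :
    ∑ w ∈ multisetPerms n t u, wordWeight q (Fin.snoc w a : Fin (n + 1) → Fin t) =
      qPochhammer q (n + 1) * PowerSeries.mk (splitQBinomProd q u (a + 1)) := by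
  induction n generalizing u a with
  | zero =>
    have hu0 : u = 0 := funext fun i => Finset.sum_eq_zero_iff.1 hu i (Finset.mem_univ i)
    have h1 : splitQBinomProd q u (a + 1) = fun _ => 1 := by
      ext m
      simp [splitQBinomProd, hu0]
    have h2 : multisetPerms 0 t u = Finset.univ := by
      ext w
      simp [multisetPerms, hu0]
    rw [h1, h2, qPochhammer_one_mul_mk_one, Fintype.sum_unique,
      wordWeight_of_le_one q le_rfl]
  | succ n ih =>
    have hstep : ∀ b, (if u b ≠ 0 then ∑ w ∈ multisetPerms n t (u - Pi.single b 1),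
          wordWeight q (Fin.snoc (Fin.snoc w b : Fin (n + 1) → Fin t) a : Fin (n + 2) → Fin t)
        else 0) = qPochhammer q (n + 1) *
          ((PowerSeries.mk (splitQBinomProd q u (b + 1)) -
            PowerSeries.mk (splitQBinomProd q u b)) *
              if a < b then C (q ^ (n + 1)) * X else 1) := by
      intro b
      have h1 : PowerSeries.mk (splitQBinomProd q u (b + 1)) -
          PowerSeries.mk (splitQBinomProd q u b) =
          if u b ≠ 0 then PowerSeries.mk (splitQBinomProd q (u - Pi.single b 1) (b + 1))
          else 0 := by
        ext m
        rw [map_sub, coeff_mk, coeff_mk, splitQBinomProd_sub]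
        split_ifs <;> simp
      rw [h1]
      by_cases hb : u b ≠ 0
      · have hsum : ∑ i, (u - Pi.single b 1 : Fin t → ℕ) i = n := by
          have h2 : u = (u - Pi.single b 1) + Pi.single b 1 := by
            ext i
            rcases eq_or_ne i b with rfl | hne
            · simp only [Pi.add_apply, Pi.sub_apply, Pi.single_eq_same]
              omega
            · simp [hne]
          rw [h2] at hu
          simp only [Pi.add_apply _ (Pi.single b 1), Finset.sum_add_distrib,
            Finset.sum_pi_single', Finset.mem_univ, if_true] at hu
          exact Nat.succ_injective hu
        rw [if_pos hb, if_pos hb, ← mul_assoc, ← ih hsum b, Finset.sum_mul]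
        refine Finset.sum_congr rfl fun w _ => ?_
        rw [wordWeight_snoc, Fin.snoc_last (α := fun _ => Fin t)]
      · rw [if_neg hb, if_neg hb, zero_mul, mul_zero]
    rw [sum_multisetPerms_succ, Finset.sum_congr rfl fun b _ => hstep b, ← Finset.mul_sum,
      sum_sub_mul_ite (fun c => PowerSeries.mk (splitQBinomProd q u c)),
      mk_splitQBinomProd_zero q hu, qPochhammer_succ q (n + 1)]
    ring

/-- MacMahon's generating function for the major index and descents of multiset permutations. -/
lemma sum_wordWeight {n t : ℕ} {v : Fin t → ℕ} (hv : ∑ i, v i = n) :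
    ∑ w ∈ multisetPerms n t v, wordWeight q w =
      qPochhammer q (n + 1) * PowerSeries.mk (fun m => ∏ i, qBinom q (m + v i) (v i)) := by
  cases t with
  | zero =>
    obtain rfl : n = 0 := by simpa using hv.symm
    have h2 : multisetPerms 0 0 v = Finset.univ := by
      ext w
      simp [multisetPerms]
    rw [h2, Fintype.sum_unique, wordWeight_of_le_one q zero_le_one]
    simpa using (qPochhammer_one_mul_mk_one q).symm
  | succ t =>
    have h := sum_wordWeight_snoc q hv (Fin.last t)
    have h2 : splitQBinomProd q v (t + 1) = _ := funext (splitQBinomProd_self q v)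
    rw [Fin.val_last, h2] at h
    rw [← h]
    refine Finset.sum_congr rfl fun w _ => ?_
    cases n with
    | zero => rw [wordWeight_of_le_one q zero_le_one, wordWeight_of_le_one q le_rfl]
    | succ n => rw [wordWeight_snoc, if_neg (Fin.le_last _).not_gt, mul_one]

lemma coeff_sum_wordWeight {n t : ℕ} (s : Finset (Fin n → Fin t)) (k : ℕ) :
    coeff k (∑ w ∈ s, wordWeight q w) = ∑ w ∈ s.filter (fun w => wDes w = k), q ^ wMaj w := by
  rw [map_sum, Finset.sum_filter]
  refine Finset.sum_congr rfl fun w _ => ?_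
  rw [wordWeight, coeff_C_mul, coeff_X_pow, mul_ite, mul_one, mul_zero]
  exact if_congr eq_comm rfl rfl

end MacMahon

theorem statement19 (t : ℕ) (v : Fin t → ℕ) (hv : ∀ a, 0 < v a) (n : ℕ)
    (hn : n = ∑ a, v a) (k : ℕ) :
    ZSU (∑ w ∈ (multisetPerms n t v).filter (fun w => wDes w = k),
          (Polynomial.X : Polynomial ℕ) ^ wMaj w)
      (n * k) := by
  obtain ⟨A, hA, -, h⟩ := exists_symmUnimodal_numerator t v
  rw [← hn] at hA h
  rw [← sum_wordWeight Polynomial.X hn.symm] at h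
  have hk := congrArg (PowerSeries.coeff k) h
  rw [coeff_sum_wordWeight, PowerSeries.coeff_mk] at hk
  have hsum : ∑ w ∈ (multisetPerms n t v).filter (fun w => wDes w = k),
      (Polynomial.X : Polynomial ℕ) ^ wMaj w = A k := by
    apply Polynomial.map_injective (Nat.castRingHom ℤ) Nat.cast_injective
    rw [← hk, Polynomial.map_sum]
    simp
  rw [hsum]
  exact (hA k).zsu
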